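/- arXiv:1608.07243 — 2 statements merged into one kernel-verified Lean document; each statement's English description precedes it below -/
import Mathlib

section
/- Let Ω = {(q1,q2) ∈ ℝ² : 0 < q2 < π} and ρ = sin(q2). For smooth f : Ω → ℝ define Δ₂ f = (4/sin²q2)·∂²f/∂q1² + ∂²f/∂q2² + (cos q2/sin q2)·∂f/∂q2 and Δ_{K2} f = ρ⁻¹·Σ_{a,b=1}^{2} ∂_a(ρ·K^{ab}·∂_b f), where K^{11} = −8·cos(q1)·cos²q2/sin²q2, K^{12} = K^{21} = −4·sin(q1)·cos q2/sin q2, K^{22} = 2·cos(q1). Then Δ₂ and Δ_{K2} commute: Δ₂(Δ_{K2} f) = Δ_{K2}(Δ₂ f) for every smooth f : Ω → ℝ. -/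
open Real

/-- Partial derivative of `f` with respect to the `i`-th coordinate. -/
noncomputable def pd {n : ℕ} (i : Fin n) (f : (Fin n → ℝ) → ℝ) (x : Fin n → ℝ) : ℝ :=
  deriv (fun t => f (Function.update x i t)) (x i)

/-- The operator `f ↦ ρ⁻¹ ∑ a b, ∂_a (ρ K^{ab} ∂_b f)` (Laplace–Beltrami-type
quantization of the symmetric tensor field `K` with respect to the weight `ρ`). -/
noncomputable def lapOp {n : ℕ} (ρ : (Fin n → ℝ) → ℝ) (K : (Fin n → ℝ) → Fin n → Fin n → ℝ)
    (f : (Fin n → ℝ) → ℝ) (x : Fin n → ℝ) : ℝ :=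
  (ρ x)⁻¹ * ∑ a, ∑ b, pd a (fun y => ρ y * K y a b * pd b f y) x

/-- `Δ₂ f = (4/sin²q2) ∂²₁ f + ∂²₂ f + cot(q2) ∂₂ f`. -/
noncomputable def lap2 (f : (Fin 2 → ℝ) → ℝ) (x : Fin 2 → ℝ) : ℝ :=
  (4/(sin (x 1))^2) * pd 0 (pd 0 f) x + pd 1 (pd 1 f) x +
    (cos (x 1)/sin (x 1)) * pd 1 f x

/-- The Killing tensor of the first integral `K2`. -/
noncomputable def K2mat (x : Fin 2 → ℝ) : Fin 2 → Fin 2 → ℝ :=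
  ![![-8 * cos (x 0) * (cos (x 1))^2/(sin (x 1))^2, -4 * sin (x 0) * cos (x 1)/sin (x 1)],
    ![-4 * sin (x 0) * cos (x 1)/sin (x 1), 2 * cos (x 0)]]

open Set Filter Topology

/-- `f` has partial derivative `v` at `x` in the `i`-th coordinate direction. -/
def HasPd {n : ℕ} (i : Fin n) (f : (Fin n → ℝ) → ℝ) (v : ℝ) (x : Fin n → ℝ) : Prop :=
  HasDerivAt (fun t => f (Function.update x i t)) v (x i)

namespace HasPd

variable {n : ℕ} {i : Fin n} {f g : (Fin n → ℝ) → ℝ} {v w : ℝ} {x : Fin n → ℝ}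

theorem pd_eq (h : HasPd i f v x) : pd i f x = v :=
  HasDerivAt.deriv h

theorem congr_val (h : HasPd i f v x) (e : v = w) : HasPd i f w x :=
  e ▸ h

theorem const (c : ℝ) : HasPd i (fun _ => c) 0 x :=
  hasDerivAt_const _ _

theorem add (hf : HasPd i f v x) (hg : HasPd i g w x) :
    HasPd i (fun y => f y + g y) (v + w) x :=
  HasDerivAt.add hf hg

theorem mul (hf : HasPd i f v x) (hg : HasPd i g w x) :
    HasPd i (fun y => f y * g y) (v * g x + f x * w) x := by
  simpa [HasPd] using HasDerivAt.fun_mul hf hg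

theorem comp_coord_self {φ : ℝ → ℝ} (h : HasDerivAt φ v (x i)) :
    HasPd i (fun y => φ (y i)) v x := by
  simpa [HasPd] using h

theorem comp_coord_ne {φ : ℝ → ℝ} {j : Fin n} (hij : j ≠ i) :
    HasPd i (fun y => φ (y j)) 0 x := by
  simpa [HasPd, hij] using hasDerivAt_const (x i) (φ (x j))

theorem of_hasFDerivAt {f' : (Fin n → ℝ) →L[ℝ] ℝ} (h : HasFDerivAt f f' x) :
    HasPd i f (f' (Pi.single i 1)) x := by
  have hu : HasDerivAt (Function.update x i) (Pi.single i (1 : ℝ)) (x i) :=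
    hasDerivAt_update x i (x i)
  refine HasFDerivAt.comp_hasDerivAt (x i) ?_ hu
  simpa using h

theorem congr_of_eventuallyEq (h : HasPd i f v x) (e : g =ᶠ[𝓝 x] f) : HasPd i g v x := by
  refine HasDerivAt.congr_of_eventuallyEq h ?_
  have hc : ContinuousAt (Function.update x i) (x i) :=
    (hasDerivAt_update x i (x i)).continuousAt
  refine hc.eventually (p := fun y => g y = f y) ?_
  simpa [EventuallyEq] using e

theorem congr_of_eqOn {s : Set (Fin n → ℝ)} (h : HasPd i f v x) (hs : IsOpen s) (hx : x ∈ s)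
    (e : EqOn g f s) : HasPd i g v x :=
  h.congr_of_eventuallyEq (e.eventuallyEq_of_mem (hs.mem_nhds hx))

theorem pd_eq_of_eqOn {s : Set (Fin n → ℝ)} (hs : IsOpen s) (hx : x ∈ s) (e : EqOn g f s)
    (h : HasPd i f v x) (hv : v = w) : pd i g x = w :=
  ((h.congr_of_eqOn hs hx e).congr_val hv).pd_eq

end HasPd

attribute [irreducible] HasPd

section Smooth

variable {n : ℕ} {s : Set (Fin n → ℝ)} {f : (Fin n → ℝ) → ℝ} {x : Fin n → ℝ}

theorem hasPd_fderiv (hs : IsOpen s) (hf : ContDiffOn ℝ (⊤ : ℕ∞) f s) (hx : x ∈ s) (i : Fin n) :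
    HasPd i f (fderiv ℝ f x (Pi.single i 1)) x :=
  .of_hasFDerivAt
    ((hf.contDiffAt (hs.mem_nhds hx)).differentiableAt (by simp)).hasFDerivAt

theorem hasPd_pd (hs : IsOpen s) (hf : ContDiffOn ℝ (⊤ : ℕ∞) f s) (hx : x ∈ s) (i : Fin n) :
    HasPd i f (pd i f x) x :=
  (hasPd_fderiv hs hf hx i).congr_val (hasPd_fderiv hs hf hx i).pd_eq.symm

theorem contDiffOn_pd (hs : IsOpen s) (hf : ContDiffOn ℝ (⊤ : ℕ∞) f s) (i : Fin n) :
    ContDiffOn ℝ (⊤ : ℕ∞) (pd i f) s :=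
  ((hf.fderiv_of_isOpen hs (m := (⊤ : ℕ∞)) (by simp)).clm_apply contDiffOn_const).congr
    fun _ hy => (hasPd_fderiv hs hf hy i).pd_eq

theorem pd_pd_eq_fderiv (hs : IsOpen s) (hf : ContDiffOn ℝ (⊤ : ℕ∞) f s) (hx : x ∈ s)
    (i j : Fin n) :
    pd i (pd j f) x = fderiv ℝ (fderiv ℝ f) x (Pi.single i 1) (Pi.single j 1) := by
  have hd : DifferentiableAt ℝ (fderiv ℝ f) x :=
    ((hf.fderiv_of_isOpen hs (m := (⊤ : ℕ∞)) (by simp)).contDiffAt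
      (hs.mem_nhds hx)).differentiableAt (by simp)
  have h := hd.hasFDerivAt.clm_apply (hasFDerivAt_const (Pi.single j (1 : ℝ)) x)
  refine (((HasPd.of_hasFDerivAt (i := i) h).congr_of_eqOn hs hx
    fun y hy => (hasPd_fderiv hs hf hy j).pd_eq).congr_val ?_).pd_eq
  simp

theorem pd_comm (hs : IsOpen s) (hf : ContDiffOn ℝ (⊤ : ℕ∞) f s) (hx : x ∈ s) (i j : Fin n) :
    pd i (pd j f) x = pd j (pd i f) x := by
  rw [pd_pd_eq_fderiv hs hf hx, pd_pd_eq_fderiv hs hf hx]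
  refine ((hf.contDiffAt (hs.mem_nhds hx)).isSymmSndFDerivAt ?_) _ _
  simpa using WithTop.coe_le_coe.2 (le_top (a := (2 : ℕ∞)))

end Smooth

/-- The strip `0 < q2 < π`. -/
def strip : Set (Fin 2 → ℝ) := {x | 0 < x 1 ∧ x 1 < π}

theorem isOpen_strip : IsOpen strip :=
  (isOpen_lt continuous_const (continuous_apply 1)).inter
    (isOpen_lt (continuous_apply 1) continuous_const)

theorem sin_ne_zero_of_mem_strip {x : Fin 2 → ℝ} (hx : x ∈ strip) : sin (x 1) ≠ 0 :=
  (sin_pos_of_pos_of_lt_pi hx.1 hx.2).ne'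

/-- The cotangent of the second coordinate. -/
noncomputable def cotQ (x : Fin 2 → ℝ) : ℝ := cos (x 1) / sin (x 1)

theorem hasPd_zero_cotQ (x : Fin 2 → ℝ) : HasPd 0 cotQ 0 x :=
  .comp_coord_ne (φ := fun t => cos t / sin t) (by decide)

theorem hasPd_one_cotQ {x : Fin 2 → ℝ} (hx : x ∈ strip) :
    HasPd 1 cotQ (-(1 + cotQ x * cotQ x)) x := by
  have hs := sin_ne_zero_of_mem_strip hx
  refine (HasPd.comp_coord_self (φ := fun t => cos t / sin t)
    ((hasDerivAt_cos _).div (hasDerivAt_sin _) hs)).congr_val ?_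
  rw [cotQ]
  field_simp
  ring

theorem contDiffOn_cotQ : ContDiffOn ℝ (⊤ : ℕ∞) cotQ strip :=
  ContDiffOn.div (by fun_prop) (by fun_prop) fun _ => sin_ne_zero_of_mem_strip

attribute [irreducible] cotQ

theorem lap2_eq {f : (Fin 2 → ℝ) → ℝ} {x : Fin 2 → ℝ} (hx : x ∈ strip) :
    lap2 f x = 4 * (1 + cotQ x * cotQ x) * pd 0 (pd 0 f) x + pd 1 (pd 1 f) x
      + cotQ x * pd 1 f x := by
  have hs := sin_ne_zero_of_mem_strip hx
  have h : 4 / sin (x 1) ^ 2 = 4 * (1 + cotQ x * cotQ x) := by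
    rw [cotQ]
    field_simp
    linarith [sin_sq_add_cos_sq (x 1)]
  rw [lap2, h, cotQ]

theorem lapOp_K2mat_eq {f : (Fin 2 → ℝ) → ℝ} (hf : ContDiffOn ℝ (⊤ : ℕ∞) f strip)
    {x : Fin 2 → ℝ} (hx : x ∈ strip) :
    lapOp (fun y => sin (y 1)) K2mat f x =
      -8 * cos (x 0) * (cotQ x * cotQ x) * pd 0 (pd 0 f) x
      + -8 * sin (x 0) * cotQ x * pd 0 (pd 1 f) x
      + 2 * cos (x 0) * pd 1 (pd 1 f) x
      + sin (x 0) * (8 * (cotQ x * cotQ x) + 4) * pd 0 f x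
      + -2 * cos (x 0) * cotQ x * pd 1 f x := by
  have hs := sin_ne_zero_of_mem_strip hx
  have hD (i j : Fin 2) : HasPd i (pd j f) (pd i (pd j f) x) x :=
    hasPd_pd isOpen_strip (contDiffOn_pd isOpen_strip hf j) hx i
  have cos0 : HasPd 0 (fun y : Fin 2 → ℝ => cos (y 0)) (-sin (x 0)) x :=
    .comp_coord_self (hasDerivAt_cos _)
  have sin0 : HasPd 0 (fun y : Fin 2 → ℝ => sin (y 0)) (cos (x 0)) x :=
    .comp_coord_self (hasDerivAt_sin _)
  have cos1 : HasPd 1 (fun y : Fin 2 → ℝ => cos (y 1)) (-sin (x 1)) x :=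
    .comp_coord_self (hasDerivAt_cos _)
  have sin1 : HasPd 1 (fun y : Fin 2 → ℝ => sin (y 1)) (cos (x 1)) x :=
    .comp_coord_self (hasDerivAt_sin _)
  have cos10 : HasPd 0 (fun y : Fin 2 → ℝ => cos (y 1)) 0 x := .comp_coord_ne (by decide)
  have sin01 : HasPd 1 (fun y : Fin 2 → ℝ => sin (y 0)) 0 x := .comp_coord_ne (by decide)
  have cos01 : HasPd 1 (fun y : Fin 2 → ℝ => cos (y 0)) 0 x := .comp_coord_ne (by decide)
  have sin10 : HasPd 0 (fun y : Fin 2 → ℝ => sin (y 1)) 0 x := .comp_coord_ne (by decide)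
  have h00 := (((((HasPd.const (-8)).mul cos0).mul cos10).mul (hasPd_zero_cotQ x)).mul
    (hD 0 0)).congr_of_eqOn (g := fun y => sin (y 1) * K2mat y 0 0 * pd 0 f y) isOpen_strip hx
    fun y hy => by
      have := sin_ne_zero_of_mem_strip hy
      simp only [K2mat, cotQ, Matrix.cons_val_zero]
      field_simp
  have h01 := ((((HasPd.const (-4)).mul sin0).mul cos10).mul
    (hD 0 1)).congr_of_eqOn (g := fun y => sin (y 1) * K2mat y 0 1 * pd 1 f y) isOpen_strip hx
    fun y hy => by
      have := sin_ne_zero_of_mem_strip hy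
      simp only [K2mat, Matrix.cons_val_zero, Matrix.cons_val_one]
      field_simp
  have h10 := ((((HasPd.const (-4)).mul sin01).mul cos1).mul
    (hD 1 0)).congr_of_eqOn (g := fun y => sin (y 1) * K2mat y 1 0 * pd 0 f y) isOpen_strip hx
    fun y hy => by
      have := sin_ne_zero_of_mem_strip hy
      simp only [K2mat, Matrix.cons_val_zero, Matrix.cons_val_one]
      field_simp
  have h11 := (((sin1.mul ((HasPd.const 2).mul cos01)).mul
    (hD 1 1)).congr_of_eqOn (g := fun y => sin (y 1) * K2mat y 1 1 * pd 1 f y) isOpen_strip hx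
    fun y hy => by simp [K2mat])
  simp only [lapOp, Fin.sum_univ_two]
  rw [h00.pd_eq, h01.pd_eq, h10.pd_eq, h11.pd_eq, pd_comm isOpen_strip hf hx 1 0, cotQ]
  field_simp
  ring

/-- The partial derivative of order `i` in the first and order `j` in the second coordinate. -/
noncomputable def mixedPd (f : (Fin 2 → ℝ) → ℝ) (i j : ℕ) : (Fin 2 → ℝ) → ℝ :=
  (pd 0)^[i] ((pd 1)^[j] f)

section MixedPd

variable {f : (Fin 2 → ℝ) → ℝ}

theorem contDiffOn_mixedPd (hf : ContDiffOn ℝ (⊤ : ℕ∞) f strip) (i j : ℕ) :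
    ContDiffOn ℝ (⊤ : ℕ∞) (mixedPd f i j) strip := by
  have h1 : ContDiffOn ℝ (⊤ : ℕ∞) ((pd 1)^[j] f) strip := by
    induction j with
    | zero => exact hf
    | succ j ih =>
      rw [Function.iterate_succ_apply']
      exact contDiffOn_pd isOpen_strip ih 1
  induction i with
  | zero => exact h1
  | succ i ih =>
    rw [mixedPd, Function.iterate_succ_apply']
    exact contDiffOn_pd isOpen_strip ih 0

theorem hasPd_zero_mixedPd (hf : ContDiffOn ℝ (⊤ : ℕ∞) f strip) (i j : ℕ)
    {x : Fin 2 → ℝ} (hx : x ∈ strip) :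
    HasPd 0 (mixedPd f i j) (mixedPd f (i + 1) j x) x := by
  rw [mixedPd, mixedPd, Function.iterate_succ_apply']
  exact hasPd_pd isOpen_strip (contDiffOn_mixedPd hf i j) hx 0

theorem hasPd_one_mixedPd (hf : ContDiffOn ℝ (⊤ : ℕ∞) f strip) (i j : ℕ)
    {x : Fin 2 → ℝ} (hx : x ∈ strip) :
    HasPd 1 (mixedPd f i j) (mixedPd f i (j + 1) x) x := by
  refine (hasPd_pd isOpen_strip (contDiffOn_mixedPd hf i j) hx 1).congr_val ?_
  induction i generalizing x with
  | zero => rw [mixedPd, mixedPd, Function.iterate_succ_apply']; rfl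
  | succ i ih =>
    have h : mixedPd f (i + 1) j = pd 0 (mixedPd f i j) := Function.iterate_succ_apply' ..
    rw [h, pd_comm isOpen_strip (contDiffOn_mixedPd hf i j) hx]
    exact ((hasPd_zero_mixedPd hf i (j + 1) hx).congr_of_eqOn isOpen_strip hx
      fun y hy => ih hy).pd_eq

end MixedPd

theorem stmt_5 (f : (Fin 2 → ℝ) → ℝ)
    (hf : ContDiffOn ℝ (⊤ : ℕ∞) f {x : Fin 2 → ℝ | 0 < x 1 ∧ x 1 < π}) :
    ∀ x : Fin 2 → ℝ, 0 < x 1 → x 1 < π →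
      lap2 (lapOp (fun y => sin (y 1)) K2mat f) x =
      lapOp (fun y => sin (y 1)) K2mat (lap2 f) x := by
  intro x hx0 hx1
  have hx : x ∈ strip := ⟨hx0, hx1⟩
  change ContDiffOn ℝ (⊤ : ℕ∞) f strip at hf
  set F := mixedPd f
  set g := lapOp (fun y => sin (y 1)) K2mat f
  set h := lap2 f
  have D0 (i j : ℕ) {y} (hy : y ∈ strip) : HasPd 0 (F i j) (F (i + 1) j y) y :=
    hasPd_zero_mixedPd hf i j hy
  have D1 (i j : ℕ) {y} (hy : y ∈ strip) : HasPd 1 (F i j) (F i (j + 1) y) y :=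
    hasPd_one_mixedPd hf i j hy
  have cos0 (y : Fin 2 → ℝ) : HasPd 0 (fun y : Fin 2 → ℝ => cos (y 0)) (-1 * sin (y 0)) y :=
    (HasPd.comp_coord_self (hasDerivAt_cos _)).congr_val (by ring)
  have sin0 (y : Fin 2 → ℝ) : HasPd 0 (fun y : Fin 2 → ℝ => sin (y 0)) (cos (y 0)) y :=
    .comp_coord_self (hasDerivAt_sin _)
  have cos01 (y : Fin 2 → ℝ) : HasPd 1 (fun y : Fin 2 → ℝ => cos (y 0)) 0 y :=
    .comp_coord_ne (by decide)
  have sin01 (y : Fin 2 → ℝ) : HasPd 1 (fun y : Fin 2 → ℝ => sin (y 0)) 0 y :=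
    .comp_coord_ne (by decide)
  have C0 := hasPd_zero_cotQ
  have C1 {y} (hy : y ∈ strip) := hasPd_one_cotQ hy
  have hg : EqOn g (fun y => -8 * cos (y 0) * (cotQ y * cotQ y) * F 2 0 y
      + -8 * sin (y 0) * cotQ y * F 1 1 y + 2 * cos (y 0) * F 0 2 y
      + sin (y 0) * (8 * (cotQ y * cotQ y) + 4) * F 1 0 y
      + -2 * cos (y 0) * cotQ y * F 0 1 y) strip := fun y hy => lapOp_K2mat_eq hf hy
  have hh : EqOn h (fun y => 4 * (1 + cotQ y * cotQ y) * F 2 0 y + F 0 2 y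
      + cotQ y * F 0 1 y) strip := fun y hy => lap2_eq hy
  have hh_smooth : ContDiffOn ℝ (⊤ : ℕ∞) h strip := by
    have hC := contDiffOn_cotQ
    refine ContDiffOn.congr ?_ hh
    exact (((contDiffOn_const.mul (contDiffOn_const.add (hC.mul hC))).mul
      (contDiffOn_mixedPd hf 2 0)).add (contDiffOn_mixedPd hf 0 2)).add
      (hC.mul (contDiffOn_mixedPd hf 0 1))
  clear_value g h F
  have hg0 : EqOn (pd 0 g) (fun y => -8 * cos (y 0) * (cotQ y * cotQ y) * F 3 0 y
      + 8 * sin (y 0) * (cotQ y * cotQ y) * F 2 0 y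
      + -8 * cos (y 0) * cotQ y * F 1 1 y + -8 * sin (y 0) * cotQ y * F 2 1 y
      + -2 * sin (y 0) * F 0 2 y + 2 * cos (y 0) * F 1 2 y
      + cos (y 0) * (8 * (cotQ y * cotQ y) + 4) * F 1 0 y
      + sin (y 0) * (8 * (cotQ y * cotQ y) + 4) * F 2 0 y
      + 2 * sin (y 0) * cotQ y * F 0 1 y + -2 * cos (y 0) * cotQ y * F 1 1 y) strip := by
    intro y hy
    apply HasPd.pd_eq_of_eqOn isOpen_strip hy hg
    · repeat' first
        | exact HasPd.const _ | exact cos0 _ | exact sin0 _ | exact C0 _ | exact D0 _ _ hy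
        | apply HasPd.add | apply HasPd.mul
    · ring
  have hg1 : EqOn (pd 1 g) (fun y => -8 * cos (y 0) * (cotQ y * cotQ y) * F 2 1 y
      + 16 * cos (y 0) * cotQ y * (1 + cotQ y * cotQ y) * F 2 0 y
      + -8 * sin (y 0) * cotQ y * F 1 2 y
      + 8 * sin (y 0) * (1 + cotQ y * cotQ y) * F 1 1 y
      + 2 * cos (y 0) * F 0 3 y + sin (y 0) * (8 * (cotQ y * cotQ y) + 4) * F 1 1 y
      + -16 * sin (y 0) * cotQ y * (1 + cotQ y * cotQ y) * F 1 0 y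
      + -2 * cos (y 0) * cotQ y * F 0 2 y
      + 2 * cos (y 0) * (1 + cotQ y * cotQ y) * F 0 1 y) strip := by
    intro y hy
    apply HasPd.pd_eq_of_eqOn isOpen_strip hy hg
    · repeat' first
        | exact HasPd.const _ | exact cos01 _ | exact sin01 _ | exact C1 hy | exact D1 _ _ hy
        | apply HasPd.add | apply HasPd.mul
    · ring
  have hh0 : EqOn (pd 0 h) (fun y => 4 * (1 + cotQ y * cotQ y) * F 3 0 y + F 1 2 y
      + cotQ y * F 1 1 y) strip := by
    intro y hy
    apply HasPd.pd_eq_of_eqOn isOpen_strip hy hh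
    · repeat' first
        | exact HasPd.const _ | exact C0 _ | exact D0 _ _ hy
        | apply HasPd.add | apply HasPd.mul
    · ring
  have hh1 : EqOn (pd 1 h) (fun y => 4 * (1 + cotQ y * cotQ y) * F 2 1 y
      + -8 * cotQ y * (1 + cotQ y * cotQ y) * F 2 0 y + F 0 3 y + cotQ y * F 0 2 y
      + -1 * (1 + cotQ y * cotQ y) * F 0 1 y) strip := by
    intro y hy
    apply HasPd.pd_eq_of_eqOn isOpen_strip hy hh
    · repeat' first
        | exact HasPd.const _ | exact C1 hy | exact D1 _ _ hy
        | apply HasPd.add | apply HasPd.mul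
    · ring
  have key {g00 g11 h00 h01 h11 : ℝ} (eg00 : HasPd 0 (pd 0 g) g00 x)
      (eg11 : HasPd 1 (pd 1 g) g11 x) (eh00 : HasPd 0 (pd 0 h) h00 x)
      (eh01 : HasPd 0 (pd 1 h) h01 x) (eh11 : HasPd 1 (pd 1 h) h11 x)
      (e : 4 * (1 + cotQ x * cotQ x) * g00 + g11 + cotQ x * pd 1 g x =
        -8 * cos (x 0) * (cotQ x * cotQ x) * h00 + -8 * sin (x 0) * cotQ x * h01
        + 2 * cos (x 0) * h11 + sin (x 0) * (8 * (cotQ x * cotQ x) + 4) * pd 0 h x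
        + -2 * cos (x 0) * cotQ x * pd 1 h x) :
      lap2 g x = lapOp (fun y => sin (y 1)) K2mat h x := by
    rw [lap2_eq hx, lapOp_K2mat_eq hh_smooth hx, eg00.pd_eq, eg11.pd_eq, eh00.pd_eq, eh01.pd_eq,
      eh11.pd_eq, e]
  apply key (HasPd.congr_of_eqOn ?_ isOpen_strip hx hg0)
    (HasPd.congr_of_eqOn ?_ isOpen_strip hx hg1) (HasPd.congr_of_eqOn ?_ isOpen_strip hx hh0)
    (HasPd.congr_of_eqOn ?_ isOpen_strip hx hh1) (HasPd.congr_of_eqOn ?_ isOpen_strip hx hh1)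
  all_goals
    repeat' first
      | exact HasPd.const _ | exact cos0 _ | exact sin0 _ | exact cos01 _ | exact sin01 _
      | exact C0 _ | exact C1 hx | exact D0 _ _ hx | exact D1 _ _ hx
      | apply HasPd.add | apply HasPd.mul
  rw [hg1 hx, hh0 hx, hh1 hx]
  ring
end

section
/- Let Ω = {(q1,q2,q3) ∈ ℝ³ : 0 < q2 < π, 0 < q3 < π}, H2 = (1/2)p2² + (2/sin²q2)·p1², H3 = (1/2)p3² + (4/sin²q3)·H2, and K2 = cos(q1)·p2² − 4·sin(q1)·(cos q2/sin q2)·p1·p2 − 4·cos(q1)·(cos²q2/sin²q2)·p1². Then {H3, K2} = 0 at every point of Ω × ℝ³. -/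
open Real

/-- Partial derivative of `F(q,p)` with respect to the coordinate `q i`. -/
noncomputable def pdq {n : ℕ} (i : Fin n) (F : (Fin n → ℝ) → (Fin n → ℝ) → ℝ)
    (q p : Fin n → ℝ) : ℝ :=
  deriv (fun t => F (Function.update q i t) p) (q i)

/-- Partial derivative of `F(q,p)` with respect to the momentum `p i`. -/
noncomputable def pdp {n : ℕ} (i : Fin n) (F : (Fin n → ℝ) → (Fin n → ℝ) → ℝ)
    (q p : Fin n → ℝ) : ℝ :=
  deriv (fun t => F q (Function.update p i t)) (p i)

/-- Canonical Poisson bracket `{F,G} = ∑ i, (∂F/∂qⁱ ∂G/∂pᵢ − ∂F/∂pᵢ ∂G/∂qⁱ)`. -/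
noncomputable def poissonBracket {n : ℕ} (F G : (Fin n → ℝ) → (Fin n → ℝ) → ℝ)
    (q p : Fin n → ℝ) : ℝ :=
  ∑ i, (pdq i F q p * pdp i G q p - pdp i F q p * pdq i G q p)

/-- `H2 = (1/2)p2² + (2/sin²q2) p1²`. -/
noncomputable def H2 (q p : Fin 3 → ℝ) : ℝ :=
  (1/2) * (p 1)^2 + (2/(sin (q 1))^2) * (p 0)^2

/-- `H3 = (1/2)p3² + (4/sin²q3) H2`. -/
noncomputable def H3 (q p : Fin 3 → ℝ) : ℝ :=
  (1/2) * (p 2)^2 + (4/(sin (q 2))^2) * H2 q p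

/-- `K2`, the quadratic first integral inherited from the two-dimensional system. -/
noncomputable def K2 (q p : Fin 3 → ℝ) : ℝ :=
  cos (q 0) * (p 1)^2 - 4 * sin (q 0) * (cos (q 1)/sin (q 1)) * (p 0) * (p 1) -
    4 * cos (q 0) * ((cos (q 1))^2/(sin (q 1))^2) * (p 0)^2

theorem hasDerivAt_two_div_sin_sq {x : ℝ} (hx : sin x ≠ 0) :
    HasDerivAt (fun t => 2 / sin t ^ 2) (-4 * cos x / sin x ^ 3) x := by
  have h := (hasDerivAt_const x (2 : ℝ)).div ((hasDerivAt_sin x).pow 2) (pow_ne_zero 2 hx)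
  refine h.congr_deriv ?_
  simp
  field_simp
  ring

theorem hasDerivAt_cos_div_sin {x : ℝ} (hx : sin x ≠ 0) :
    HasDerivAt (fun t => cos t / sin t) (-1 / sin x ^ 2) x := by
  have h := (hasDerivAt_cos x).div (hasDerivAt_sin x) hx
  refine h.congr_deriv ?_
  congr 1
  linear_combination -sin_sq_add_cos_sq x

theorem hasDerivAt_cos_sq_div_sin_sq {x : ℝ} (hx : sin x ≠ 0) :
    HasDerivAt (fun t => cos t ^ 2 / sin t ^ 2) (-2 * cos x / sin x ^ 3) x := by
  have h := (hasDerivAt_cos_div_sin hx).pow 2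
  have e : (fun t => cos t / sin t) ^ 2 = fun t => cos t ^ 2 / sin t ^ 2 := by
    ext t
    simp [div_pow]
  rw [e] at h
  refine h.congr_deriv ?_
  simp
  field_simp

theorem pdq_zero_H3 (q p : Fin 3 → ℝ) : pdq 0 H3 q p = 0 := by
  simp [pdq, H3, H2]

theorem pdq_one_H3 (q p : Fin 3 → ℝ) (hs : sin (q 1) ≠ 0) :
    pdq 1 H3 q p = 4 / sin (q 2) ^ 2 * (-4 * cos (q 1) / sin (q 1) ^ 3 * p 0 ^ 2) := by
  simp only [pdq, H3, H2, Function.update_self, ne_eq, Fin.reduceEq, not_false_eq_true,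
    Function.update_of_ne]
  exact (((((hasDerivAt_two_div_sin_sq hs).mul_const (p 0 ^ 2)).const_add _).const_mul _).const_add
    _).deriv

theorem pdp_zero_H3 (q p : Fin 3 → ℝ) :
    pdp 0 H3 q p = 4 / sin (q 2) ^ 2 * (2 / sin (q 1) ^ 2 * (2 * p 0)) := by
  simp only [pdp, H3, H2, Function.update_self, ne_eq, Fin.reduceEq, not_false_eq_true,
    Function.update_of_ne, one_ne_zero]
  refine ((((((hasDerivAt_id (p 0)).pow 2).const_mul _).const_add _).const_mul _).const_add
    _).deriv.trans ?_
  simp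

theorem pdp_one_H3 (q p : Fin 3 → ℝ) :
    pdp 1 H3 q p = 4 / sin (q 2) ^ 2 * p 1 := by
  simp only [pdp, H3, H2, Function.update_self, ne_eq, Fin.reduceEq, not_false_eq_true,
    Function.update_of_ne, zero_ne_one]
  refine ((((((hasDerivAt_id (p 1)).pow 2).const_mul _).add_const _).const_mul _).const_add
    _).deriv.trans ?_
  simp

theorem pdq_zero_K2 (q p : Fin 3 → ℝ) :
    pdq 0 K2 q p = -sin (q 0) * p 1 ^ 2 - 4 * cos (q 0) * (cos (q 1) / sin (q 1)) * p 0 * p 1 -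
      4 * -sin (q 0) * (cos (q 1) ^ 2 / sin (q 1) ^ 2) * p 0 ^ 2 := by
  simp only [pdq, K2, Function.update_self, ne_eq, not_false_eq_true,
    Function.update_of_ne, one_ne_zero]
  exact ((((hasDerivAt_cos (q 0)).mul_const _).sub
    (((((hasDerivAt_sin (q 0)).const_mul 4).mul_const _).mul_const _).mul_const _)).sub
    ((((hasDerivAt_cos (q 0)).const_mul 4).mul_const _).mul_const _)).deriv

theorem pdq_one_K2 (q p : Fin 3 → ℝ) (hs : sin (q 1) ≠ 0) :
    pdq 1 K2 q p = 0 - 4 * sin (q 0) * (-1 / sin (q 1) ^ 2) * p 0 * p 1 -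
      4 * cos (q 0) * (-2 * cos (q 1) / sin (q 1) ^ 3) * p 0 ^ 2 := by
  simp only [pdq, K2, Function.update_self, ne_eq, not_false_eq_true,
    Function.update_of_ne, zero_ne_one]
  exact (((hasDerivAt_const (q 1) _).sub
    ((((hasDerivAt_cos_div_sin hs).const_mul _).mul_const _).mul_const _)).sub
    (((hasDerivAt_cos_sq_div_sin_sq hs).const_mul _).mul_const _)).deriv

theorem pdp_one_K2 (q p : Fin 3 → ℝ) :
    pdp 1 K2 q p = 2 * cos (q 0) * p 1 - 4 * sin (q 0) * (cos (q 1) / sin (q 1)) * p 0 := by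
  simp only [pdp, K2, Function.update_self, ne_eq, not_false_eq_true,
    Function.update_of_ne, zero_ne_one]
  refine (((((hasDerivAt_id (p 1)).pow 2).const_mul _).sub
    ((hasDerivAt_id (p 1)).const_mul _)).sub_const _).deriv.trans ?_
  simp
  ring

theorem pdq_two_K2 (q p : Fin 3 → ℝ) : pdq 2 K2 q p = 0 := by
  simp [pdq, K2]

theorem pdp_two_K2 (q p : Fin 3 → ℝ) : pdp 2 K2 q p = 0 := by
  simp [pdp, K2]

theorem stmt_7 (q p : Fin 3 → ℝ) (h2 : 0 < q 1) (h2' : q 1 < π)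
    (h3 : 0 < q 2) (h3' : q 2 < π) :
    poissonBracket H3 K2 q p = 0 := by
  have hs : sin (q 1) ≠ 0 := (sin_pos_of_pos_of_lt_pi h2 h2').ne'
  rw [poissonBracket, Fin.sum_univ_three, pdq_zero_H3, pdq_one_H3 q p hs, pdp_zero_H3, pdp_one_H3,
    pdq_zero_K2, pdq_one_K2 q p hs, pdp_one_K2, pdq_two_K2, pdp_two_K2]
  field_simp
  ring
end
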